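/- arXiv:2112.13130 — 3 statements merged into one kernel-verified Lean document; each statement's English description precedes it below -/
import Mathlib

section
/- For every integer n ≥ 2 and every real q ≥ 2 there exists a constant C > 0 (depending only on n and q) such that for all a₁, …, a_n ∈ ℂ, | |a₁ + ⋯ + a_n|^q − (|a₁|^q + ⋯ + |a_n|^q) | ≤ C · max_{1 ≤ j ≠ j′ ≤ n} |a_j| · |a_{j′}|^{q−1}. -/
/-- Mean value estimate for `x ↦ x ^ p` on `[0, B]`. -/
theorem abs_rpow_sub_rpow_le {p B x y : ℝ} (hp : 1 ≤ p) (hx : x ∈ Set.Icc 0 B)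
    (hy : y ∈ Set.Icc 0 B) : |x ^ p - y ^ p| ≤ p * B ^ (p - 1) * |x - y| := by
  have hderiv : ∀ t ∈ Set.Icc (0 : ℝ) B,
      HasDerivWithinAt (fun t : ℝ => t ^ p) (p * t ^ (p - 1)) (Set.Icc 0 B) t :=
    fun t _ => (Real.hasDerivAt_rpow_const (Or.inr hp)).hasDerivWithinAt
  have hbound : ∀ t ∈ Set.Icc (0 : ℝ) B, ‖p * t ^ (p - 1)‖ ≤ p * B ^ (p - 1) := by
    rintro t ⟨ht0, htB⟩
    rw [Real.norm_of_nonneg (by positivity)]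
    have := Real.rpow_le_rpow ht0 htB (sub_nonneg.2 hp)
    gcongr
  exact (convex_Icc 0 B).norm_image_sub_le_of_norm_hasDerivWithin_le hderiv hbound hy hx

/-- If `a k` has maximal norm and `M` bounds the products `‖a j‖ * ‖a k‖ ^ (q - 1)`, `j ≠ k`,
then the defect of additivity of `‖·‖ ^ q` is bounded by a multiple of `M`. -/
theorem abs_norm_sum_rpow_sub_sum_le {ι E : Type*} [Fintype ι] [DecidableEq ι]
    [SeminormedAddCommGroup E] {q M : ℝ} (hq : 1 < q) (a : ι → E) (k : ι)
    (hk : ∀ j, ‖a j‖ ≤ ‖a k‖) (hM0 : 0 ≤ M)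
    (hM : ∀ j ≠ k, ‖a j‖ * ‖a k‖ ^ (q - 1) ≤ M) :
    |‖∑ j, a j‖ ^ q - ∑ j, ‖a j‖ ^ q| ≤
      (q * (Fintype.card ι : ℝ) ^ (q - 1) + 1) * (Fintype.card ι * M) := by
  set N : ℝ := (Fintype.card ι : ℝ)
  set s : Finset ι := Finset.univ.erase k
  have hN1 : 1 ≤ N := Nat.one_le_cast.2 (Fintype.card_pos_iff.2 ⟨k⟩)
  have hsN : (s.card : ℝ) ≤ N := Nat.cast_le.2 (Finset.card_le_univ s)
  have hrest : ∑ j ∈ s, ‖a j‖ * ‖a k‖ ^ (q - 1) ≤ N * M := by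
    calc _ ≤ s.card • M :=
          Finset.sum_le_card_nsmul _ _ _ fun j hj => hM j (Finset.ne_of_mem_erase hj)
      _ = s.card * M := nsmul_eq_mul _ _
      _ ≤ N * M := by gcongr
  have hpow : ∑ j ∈ s, ‖a j‖ ^ q ≤ N * M := by
    refine (Finset.sum_le_sum fun j _ => ?_).trans hrest
    have h := Real.rpow_one_add' (norm_nonneg (a j)) (y := q - 1) (by linarith)
    rw [add_sub_cancel] at h
    rw [h]
    exact mul_le_mul_of_nonneg_left
      (Real.rpow_le_rpow (norm_nonneg _) (hk j) (by linarith)) (norm_nonneg _)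
  have hsum : ‖∑ j, a j‖ ≤ N * ‖a k‖ := by
    refine (norm_sum_le_of_le _ fun j _ => hk j).trans_eq ?_
    simp [N]
  have hdiff : |‖∑ j, a j‖ - ‖a k‖| ≤ ∑ j ∈ s, ‖a j‖ := by
    refine (abs_norm_sub_norm_le _ _).trans ?_
    rw [← Finset.add_sum_erase _ a (Finset.mem_univ k), add_sub_cancel_left]
    exact norm_sum_le _ _
  have hmain : |‖∑ j, a j‖ ^ q - ‖a k‖ ^ q| ≤ q * N ^ (q - 1) * (N * M) := by
    calc _ ≤ q * (N * ‖a k‖) ^ (q - 1) * |‖∑ j, a j‖ - ‖a k‖| :=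
          abs_rpow_sub_rpow_le hq.le ⟨norm_nonneg _, hsum⟩
            ⟨norm_nonneg _, le_mul_of_one_le_left (norm_nonneg _) hN1⟩
      _ ≤ q * (N * ‖a k‖) ^ (q - 1) * ∑ j ∈ s, ‖a j‖ := by gcongr
      _ = q * N ^ (q - 1) * ∑ j ∈ s, ‖a j‖ * ‖a k‖ ^ (q - 1) := by
          rw [Real.mul_rpow (by positivity) (norm_nonneg _), ← Finset.sum_mul]
          ring
      _ ≤ _ := by gcongr
  have hpow0 : 0 ≤ ∑ j ∈ s, ‖a j‖ ^ q := by positivity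
  rw [← Finset.add_sum_erase _ (fun j => ‖a j‖ ^ q) (Finset.mem_univ k)]
  rw [abs_le] at hmain ⊢
  constructor <;> linarith

/-- Lemma 3.6 (elementary calculus lemma): for `n ≥ 2` and `q ≥ 2` there is `C > 0`
such that for all `a₁, …, a_n ∈ ℂ`,
`| |Σ a_j|^q − Σ |a_j|^q | ≤ C · max_{j ≠ j'} |a_j| |a_{j'}|^{q−1}`. -/
theorem statement12 (n : ℕ) (hn : 2 ≤ n) (q : ℝ) (hq : 2 ≤ q) :
    ∃ C > 0, ∀ a : Fin n → ℂ,
      |‖∑ j, a j‖ ^ q - ∑ j, ‖a j‖ ^ q| ≤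
        C * sSup {r : ℝ | ∃ j j' : Fin n, j ≠ j' ∧ r = ‖a j‖ * ‖a j'‖ ^ (q - 1)} := by
  have hn0 : (0 : ℝ) < n := by exact_mod_cast (by omega : 0 < n)
  refine ⟨(q * (n : ℝ) ^ (q - 1) + 1) * n, by positivity, fun a => ?_⟩
  have : Nonempty (Fin n) := ⟨⟨0, by omega⟩⟩
  obtain ⟨k, hk⟩ := Finite.exists_max fun j => ‖a j‖
  set S := {r : ℝ | ∃ j j' : Fin n, j ≠ j' ∧ r = ‖a j‖ * ‖a j'‖ ^ (q - 1)}
  have hS : BddAbove S := by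
    refine ((Set.finite_range fun p : Fin n × Fin n =>
      ‖a p.1‖ * ‖a p.2‖ ^ (q - 1)).subset ?_).bddAbove
    rintro r ⟨j, j', -, rfl⟩
    exact ⟨(j, j'), rfl⟩
  have hS0 : 0 ≤ sSup S := by
    refine Real.sSup_nonneg ?_
    rintro r ⟨j, j', -, rfl⟩
    positivity
  have h := abs_norm_sum_rpow_sub_sum_le (by linarith) a k hk hS0
    fun j hj => le_csSup hS ⟨j, k, hj, rfl⟩
  rwa [Fintype.card_fin, ← mul_assoc] at h
end

section
/- Let q > 2 be real. Then the function φ : [0,1] → ℝ defined by φ(t) := (1/π) ∫₀^π (1 + t cos θ)^{q/2} dθ is strictly increasing on [0,1]; indeed φ′(t) > 0 for every t ∈ (0,1). -/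
open scoped Real

noncomputable section

/-- The function `φ(t) = (1/π) ∫₀^π (1 + t cos θ)^{q/2} dθ`. -/
def phiFun (q : ℝ) (t : ℝ) : ℝ :=
  (1 / Real.pi) * ∫ θ in (0:ℝ)..Real.pi, (1 + t * Real.cos θ) ^ (q / 2)

/-- Differentiation under the integral sign for `∫₀^π (1 + t cos θ)^p dθ`. -/
theorem hasDerivAt_integral_one_add_mul_cos_rpow {p : ℝ} (hp : 1 < p) (t : ℝ) :
    HasDerivAt (fun s : ℝ => ∫ θ in (0:ℝ)..π, (1 + s * Real.cos θ) ^ p)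
      (∫ θ in (0:ℝ)..π, Real.cos θ * (p * (1 + t * Real.cos θ) ^ (p - 1))) t := by
  have hcont (r : ℝ) (hr : 0 < r) (s : ℝ) :
      Continuous fun θ : ℝ => (1 + s * Real.cos θ) ^ r :=
    Continuous.rpow_const (by fun_prop) fun _ => Or.inr hr.le
  refine (intervalIntegral.hasDerivAt_integral_of_dominated_loc_of_deriv_le
    (F' := fun s θ => Real.cos θ * (p * (1 + s * Real.cos θ) ^ (p - 1)))
    (bound := fun _ => p * (2 + |t|) ^ (p - 1))
    (Metric.ball_mem_nhds t one_pos)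
    (.of_forall fun s => (hcont p (by linarith) s).aestronglyMeasurable)
    ((hcont p (by linarith) t).intervalIntegrable _ _)
    (Real.continuous_cos.mul
      (continuous_const.mul (hcont (p - 1) (by linarith) t))).aestronglyMeasurable
    (.of_forall fun θ _ s hs => ?_) intervalIntegrable_const
    (.of_forall fun θ _ s _ => ?_)).2
  · have hs' : |s| ≤ 1 + |t| := by
      have h1 : |s - t| < 1 := by simpa [Real.dist_eq] using hs
      have h2 := abs_sub_abs_le_abs_sub s t
      linarith
    have hbase : |1 + s * Real.cos θ| ≤ 2 + |t| := by
      have h1 := abs_add_le 1 (s * Real.cos θ)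
      have h2 : |s * Real.cos θ| ≤ |s| := by
        rw [abs_mul]
        exact mul_le_of_le_one_right (abs_nonneg s) (Real.abs_cos_le_one θ)
      rw [abs_one] at h1
      linarith
    have hpow : |(1 + s * Real.cos θ) ^ (p - 1)| ≤ (2 + |t|) ^ (p - 1) :=
      (Real.abs_rpow_le_abs_rpow _ _).trans
        (Real.rpow_le_rpow (abs_nonneg _) hbase (by linarith))
    have hp0 : 0 < p := by linarith
    rw [Real.norm_eq_abs, abs_mul, abs_mul, abs_of_pos hp0]
    calc |Real.cos θ| * (p * |(1 + s * Real.cos θ) ^ (p - 1)|)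
        ≤ 1 * (p * (2 + |t|) ^ (p - 1)) := by
          gcongr
          exact Real.abs_cos_le_one θ
      _ = p * (2 + |t|) ^ (p - 1) := one_mul _
  · have hlin : HasDerivAt (fun s : ℝ => 1 + s * Real.cos θ) (Real.cos θ) s := by
      simpa using ((hasDerivAt_id s).mul_const (Real.cos θ)).const_add 1
    have h := (Real.hasDerivAt_rpow_const (x := 1 + s * Real.cos θ) (Or.inr hp.le)).comp s hlin
    rw [mul_comm] at h
    exact h

/-- Since `∫₀^π cos θ dθ = 0`, the weight `(1 + t cos θ)^r` may be replaced by
`(1 + t cos θ)^r - 1`, which has the same sign as `cos θ`. -/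
theorem integral_cos_mul_one_add_mul_cos_rpow_pos {r t : ℝ} (hr : 0 < r) (ht0 : 0 < t)
    (ht1 : t ≤ 1) : 0 < ∫ θ in (0:ℝ)..π, Real.cos θ * (1 + t * Real.cos θ) ^ r := by
  have hcont : Continuous fun θ : ℝ => Real.cos θ * (1 + t * Real.cos θ) ^ r :=
    Real.continuous_cos.mul (Continuous.rpow_const (by fun_prop) fun _ => Or.inr hr.le)
  have hshift : ∫ θ in (0:ℝ)..π, Real.cos θ * (1 + t * Real.cos θ) ^ r =
      ∫ θ in (0:ℝ)..π, (Real.cos θ * (1 + t * Real.cos θ) ^ r - Real.cos θ) := by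
    rw [intervalIntegral.integral_sub (hcont.intervalIntegrable _ _)
      (Real.continuous_cos.intervalIntegrable _ _)]
    simp
  rw [hshift]
  refine intervalIntegral.integral_pos Real.pi_pos (hcont.sub Real.continuous_cos).continuousOn
    (fun θ _ => ?_) ⟨0, ⟨le_rfl, Real.pi_pos.le⟩, ?_⟩
  · rw [← mul_sub_one]
    rcases le_total 0 (Real.cos θ) with hc | hc
    · have hbase : 1 ≤ 1 + t * Real.cos θ := by nlinarith
      exact mul_nonneg hc (sub_nonneg.2 (Real.one_le_rpow hbase hr.le))
    · have hbase0 : 0 ≤ 1 + t * Real.cos θ := by nlinarith [Real.neg_one_le_cos θ]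
      have hbase1 : 1 + t * Real.cos θ ≤ 1 := by nlinarith
      exact mul_nonneg_of_nonpos_of_nonpos hc
        (sub_nonpos.2 (Real.rpow_le_one hbase0 hbase1 hr.le))
  · have h : 1 < (1 + t) ^ r := Real.one_lt_rpow (by linarith) hr
    simpa using h

/-- For `q > 2`, `φ(t) = (1/π)∫₀^π (1 + t cos θ)^{q/2} dθ` is strictly increasing on
`[0,1]`; indeed `φ'(t) > 0` for every `t ∈ (0,1)`. -/
theorem statement15 (q : ℝ) (hq : 2 < q) :
    StrictMonoOn (phiFun q) (Set.Icc 0 1) ∧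
    ∀ t ∈ Set.Ioo (0 : ℝ) 1, 0 < deriv (phiFun q) t := by
  have hderiv (t : ℝ) : HasDerivAt (phiFun q) ((1 / π) *
      ∫ θ in (0:ℝ)..π, Real.cos θ * (q / 2 * (1 + t * Real.cos θ) ^ (q / 2 - 1))) t :=
    (hasDerivAt_integral_one_add_mul_cos_rpow (by linarith) t).const_mul _
  have hpos : ∀ t ∈ Set.Ioo (0 : ℝ) 1, 0 < deriv (phiFun q) t := by
    rintro t ⟨ht0, ht1⟩
    rw [(hderiv t).deriv]
    simp_rw [mul_left_comm _ (q / 2)]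
    rw [intervalIntegral.integral_const_mul]
    have h := integral_cos_mul_one_add_mul_cos_rpow_pos (r := q / 2 - 1) (by linarith) ht0 ht1.le
    have hq0 : 0 < q := by linarith
    positivity
  refine ⟨strictMonoOn_of_deriv_pos (convex_Icc 0 1)
    (fun t _ => (hderiv t).continuousAt.continuousWithinAt) ?_, hpos⟩
  rwa [interior_Icc]
end
end

section
/- For every real q > 0 and every z ∈ ℂ, (1/2π) ∫₀^{2π} |z + e^{iθ} · conj(z)|^q dθ = (2^q/√π) · (Γ((q+1)/2)/Γ((q+2)/2)) · |z|^q. -/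
open Real intervalIntegral MeasureTheory

/-- The real Euler beta integral in terms of the Gamma function. -/
theorem integral_rpow_mul_one_sub_rpow {a b : ℝ} (ha : 0 < a) (hb : 0 < b) :
    ∫ t in (0:ℝ)..1, t ^ (a - 1) * (1 - t) ^ (b - 1) = Gamma a * Gamma b / Gamma (a + b) := by
  have h := Complex.betaIntegral_eq_Gamma_mul_div (a : ℂ) b (by simpa) (by simpa)
  rw [← Complex.ofReal_add, Complex.Gamma_ofReal, Complex.Gamma_ofReal, Complex.Gamma_ofReal] at h
  rw [← Complex.ofReal_inj, ← intervalIntegral.integral_ofReal]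
  push_cast
  rw [← h, Complex.betaIntegral]
  refine integral_congr fun t ht ↦ ?_
  rw [Set.uIcc_of_le zero_le_one] at ht
  simp only [Complex.ofReal_cpow ht.1, Complex.ofReal_cpow (sub_nonneg.2 ht.2)]
  push_cast
  rfl

theorem integral_sin_rpow_zero_pi_div_two {q : ℝ} (hq : -1 < q) :
    ∫ x in (0:ℝ)..π / 2, sin x ^ q = √π / 2 * (Gamma ((q + 1) / 2) / Gamma ((q + 2) / 2)) := by
  have hpi := Real.pi_pos
  have hle : (0:ℝ) ≤ π / 2 := by positivity
  have hpos : ∀ x ∈ Set.Ioo 0 (π / 2), 0 < sin x ∧ 0 < cos x := fun x hx ↦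
    ⟨sin_pos_of_pos_of_lt_pi hx.1 (by linarith [hx.2]),
      cos_pos_of_mem_Ioo ⟨by linarith [hx.1], hx.2⟩⟩
  have hsub := integral_comp_mul_deriv_of_deriv_nonneg (a := 0) (b := π / 2)
    (f := fun x ↦ sin x ^ 2) (f' := fun x ↦ 2 * sin x * cos x)
    (g := fun t ↦ t ^ ((q + 1) / 2 - 1) * (1 - t) ^ ((1 / 2 : ℝ) - 1))
    (by fun_prop)
    (fun x _ ↦ by simpa using (hasDerivAt_sin x).fun_pow 2)
    (fun x hx ↦ by
      rw [min_eq_left hle, max_eq_right hle] at hx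
      have := hpos x hx
      nlinarith [mul_pos this.1 this.2])
  have hbeta := integral_rpow_mul_one_sub_rpow (a := (q + 1) / 2) (b := 1 / 2)
    (by linarith) (by norm_num)
  simp only [sin_zero, sin_pi_div_two, one_pow, ne_eq, OfNat.ofNat_ne_zero, not_false_eq_true,
    zero_pow] at hsub
  rw [hbeta, Real.Gamma_one_half_eq, show (q + 1) / 2 + 1 / 2 = (q + 2) / 2 by ring] at hsub
  have hcongr : ∫ x in (0:ℝ)..π / 2, sin x ^ q = ∫ x in (0:ℝ)..π / 2, (1 / 2 : ℝ) *
      (((fun t : ℝ ↦ t ^ ((q + 1) / 2 - 1) * (1 - t) ^ ((1 / 2 : ℝ) - 1)) ∘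
        fun x ↦ sin x ^ 2) x * (2 * sin x * cos x)) := by
    rw [integral_of_le hle, integral_of_le hle, integral_Ioc_eq_integral_Ioo,
      integral_Ioc_eq_integral_Ioo]
    refine setIntegral_congr_fun measurableSet_Ioo fun x hx ↦ ?_
    obtain ⟨hs, hc⟩ := hpos x hx
    have hs' : (sin x ^ 2) ^ ((q + 1) / 2 - 1) * sin x = sin x ^ q := by
      rw [← rpow_natCast, ← rpow_mul hs.le, ← rpow_add_one hs.ne']
      congr 1
      push_cast
      ring
    have hc' : (1 - sin x ^ 2) ^ ((1 / 2 : ℝ) - 1) * cos x = 1 := by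
      rw [← cos_sq', ← rpow_natCast, ← rpow_mul hc.le, ← rpow_add_one hc.ne']
      norm_num
    simp only [Function.comp_apply]
    linear_combination (-1 : ℝ) * hs' -
      (sin x ^ 2) ^ ((q + 1) / 2 - 1) * sin x * hc'
  rw [hcongr, intervalIntegral.integral_const_mul, hsub]
  ring

theorem integral_abs_cos_rpow_period {q : ℝ} (hq : 0 ≤ q) (t : ℝ) :
    ∫ x in t..t + π, |cos x| ^ q = √π * (Gamma ((q + 1) / 2) / Gamma ((q + 2) / 2)) := by
  have hpi := Real.pi_pos
  have hper : Function.Periodic (fun x ↦ |cos x| ^ q) π := fun x ↦ by simp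
  have hcont : Continuous fun x ↦ |cos x| ^ q :=
    continuous_cos.abs.rpow_const fun _ ↦ Or.inr hq
  have hsin : ∫ x in (0:ℝ)..π / 2, |cos (π / 2 - x)| ^ q = ∫ x in (0:ℝ)..π / 2, sin x ^ q := by
    refine integral_congr fun x hx ↦ ?_
    rw [Set.uIcc_of_le (by positivity)] at hx
    simp only [cos_pi_div_two_sub]
    rw [abs_of_nonneg (sin_nonneg_of_nonneg_of_le_pi hx.1 (by linarith [hx.2]))]
  have hright : ∫ x in (0:ℝ)..π / 2, |cos x| ^ q = ∫ x in (0:ℝ)..π / 2, sin x ^ q := by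
    rw [← hsin, integral_comp_sub_left (fun x ↦ |cos x| ^ q)]
    simp
  have hleft : ∫ x in -(π / 2)..0, |cos x| ^ q = ∫ x in (0:ℝ)..π / 2, |cos x| ^ q := by
    have h := integral_comp_neg (a := 0) (b := π / 2) fun x ↦ |cos x| ^ q
    simpa using h.symm
  rw [hper.intervalIntegral_add_eq t (-(π / 2)), show -(π / 2) + π = π / 2 by ring,
    ← integral_add_adjacent_intervals (hcont.intervalIntegrable _ 0)
      (hcont.intervalIntegrable 0 _), hleft, hright,
    integral_sin_rpow_zero_pi_div_two (by linarith)]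
  ring

theorem norm_add_exp_mul_conj (z : ℂ) (θ : ℝ) :
    ‖z + Complex.exp (Complex.I * (θ : ℂ)) * starRingEnd ℂ z‖ =
      2 * ‖z‖ * |cos (θ / 2 - z.arg)| := by
  have hz : z + Complex.exp (Complex.I * (θ : ℂ)) * starRingEnd ℂ z =
      Complex.exp ((θ / 2 : ℝ) * Complex.I) *
        ((2 * ‖z‖ * cos (θ / 2 - z.arg) : ℝ) : ℂ) := by
    have hpolar := Complex.norm_mul_exp_arg_mul_I z
    have hconj : starRingEnd ℂ z = ‖z‖ * Complex.exp (-(z.arg * Complex.I)) := by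
      conv_lhs => rw [← hpolar]
      rw [map_mul, Complex.conj_ofReal, ← Complex.exp_conj]
      simp
    rw [hconj]
    conv_lhs => enter [1]; rw [← hpolar]
    push_cast
    rw [Complex.cos, show ∀ a b c d : ℂ, a * (2 * b * ((c + d) / 2)) = b * (a * c) + b * (a * d)
      from fun a b c d ↦ by ring, ← Complex.exp_add, ← Complex.exp_add, mul_left_comm,
      ← Complex.exp_add, add_comm]
    congr 3 <;> ring_nf
  rw [hz, norm_mul, Complex.norm_exp_ofReal_mul_I, one_mul, Complex.norm_real, Real.norm_eq_abs,
    abs_mul, abs_of_nonneg (by positivity)]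

noncomputable section

/-- For every `q > 0` and `z ∈ ℂ`,
`(1/2π) ∫₀^{2π} |z + e^{iθ} conj(z)|^q dθ = (2^q/√π)·(Γ((q+1)/2)/Γ((q+2)/2))·|z|^q`. -/
theorem statement19 (q : ℝ) (hq : 0 < q) (z : ℂ) :
    (1 / (2 * Real.pi)) *
        ∫ θ in (0:ℝ)..(2 * Real.pi), ‖z + Complex.exp (Complex.I * (θ : ℂ)) * starRingEnd ℂ z‖ ^ q =
      ((2 : ℝ) ^ q / Real.sqrt Real.pi) *
        (Real.Gamma ((q + 1) / 2) / Real.Gamma ((q + 2) / 2)) * ‖z‖ ^ q := by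
  have hint : ∫ θ in (0:ℝ)..(2 * π), |cos (θ / 2 - z.arg)| ^ q =
      2 * (√π * (Gamma ((q + 1) / 2) / Gamma ((q + 2) / 2))) := by
    rw [integral_comp_div_sub (fun x ↦ |cos x| ^ q) two_ne_zero,
      ← integral_abs_cos_rpow_period hq.le (0 / 2 - z.arg), smul_eq_mul]
    congr 2
    ring
  have hsqrt : √π ^ 2 = π := sq_sqrt pi_pos.le
  have hne : √π ≠ 0 := (sqrt_pos.2 pi_pos).ne'
  simp_rw [norm_add_exp_mul_conj, mul_rpow (mul_nonneg zero_le_two (norm_nonneg z)) (abs_nonneg _),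
    mul_rpow zero_le_two (norm_nonneg z)]
  rw [intervalIntegral.integral_const_mul, hint]
  nth_rewrite 1 [← hsqrt]
  field_simp
end
end
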